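/- arXiv:0708.2636 — 2 statements merged into one kernel-verified Lean document; each statement's English description precedes it below -/
import Mathlib

section
/- The quadratic form q(x) = h(x, βx) on V is anisotropic (i.e. q(x) = 0 implies x = 0) if and only if E/F is biquadratic and, for every z ∈ E₀^× with tr_{E₀/F}(z) = 0, one has β δ₀ z⁻¹ ∉ N_{E/E₀}(E^×). (Case (i) of Proposition 4.2, combined with Proposition 4.1.) -/
/-- Encoding of a nonarchimedean local field via a (normalized, surjective)
additive valuation `ν : K → ℤ` with junk value at `0`:  `ν` is additive on
products and ultrametric on nonzero elements, `ν(K^×) = ℤ`, the field is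
complete (every `ν`-Cauchy sequence converges), and the residue field is
finite (finitely many residue classes of integers). -/
structure IsNALocalField {K : Type*} [Field K] (ν : K → ℤ) : Prop where
  map_mul : ∀ x y : K, x ≠ 0 → y ≠ 0 → ν (x * y) = ν x + ν y
  ultrametric : ∀ x y : K, x ≠ 0 → y ≠ 0 → x + y ≠ 0 → min (ν x) (ν y) ≤ ν (x + y)
  surj : ∀ n : ℤ, ∃ x : K, x ≠ 0 ∧ ν x = n
  complete : ∀ a : ℕ → K,
    (∀ N : ℤ, ∃ M : ℕ, ∀ m ≥ M, ∀ n ≥ M, a m = a n ∨ N ≤ ν (a m - a n)) →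
    ∃ L : K, ∀ N : ℤ, ∃ M : ℕ, ∀ m ≥ M, a m = L ∨ N ≤ ν (a m - L)
  finiteResidue : ∃ S : Finset K, ∀ x : K, (x = 0 ∨ 0 ≤ ν x) →
    ∃ y ∈ S, x = y ∨ 0 < ν (x - y)

/-- Odd residual characteristic: `2` is a unit of the valuation ring
(equivalently, the characteristic of the residue field is odd). -/
def OddResidualChar {K : Type*} [Field K] (ν : K → ℤ) : Prop :=
  (2 : K) ≠ 0 ∧ ν (2 : K) = 0

/-- `E/F` is biquadratic: Galois with group `ℤ/2ℤ × ℤ/2ℤ`. -/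
def IsBiquadratic (F E : Type*) [Field F] [Field E] [Algebra F E] : Prop :=
  IsGalois F E ∧ Nonempty ((E ≃ₐ[F] E) ≃* Multiplicative (ZMod 2 × ZMod 2))

namespace IsNALocalField

variable {K : Type*} [Field K] {ν : K → ℤ}

theorem val_one (hF : IsNALocalField ν) : ν 1 = 0 := by
  have h := hF.map_mul 1 1 one_ne_zero one_ne_zero
  rw [mul_one] at h
  omega

theorem val_neg (hF : IsNALocalField ν) (x : K) : ν (-x) = ν x := by
  by_cases hx : x = 0
  · simp [hx]
  have h1 : ν (-1) = 0 := by
    have h := hF.map_mul (-1) (-1) (by simp) (by simp)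
    rw [neg_mul_neg, mul_one, hF.val_one] at h
    omega
  rw [← neg_one_mul, hF.map_mul _ _ (by simp) hx, h1, zero_add]

theorem val_inv (hF : IsNALocalField ν) (x : K) (hx : x ≠ 0) : ν x⁻¹ = -ν x := by
  have h := hF.map_mul x x⁻¹ hx (inv_ne_zero hx)
  rw [mul_inv_cancel₀ hx, hF.val_one] at h
  omega

end IsNALocalField

/-- `x` lies in the fractional ideal of elements of valuation at least `N`. -/
def ValGE {K : Type*} [Field K] (ν : K → ℤ) (N : ℤ) (x : K) : Prop :=
  x = 0 ∨ N ≤ ν x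

namespace ValGE

variable {K : Type*} [Field K] {ν : K → ℤ} {M N : ℤ} {x y : K}

theorem mono (h : ValGE ν N x) (hMN : M ≤ N) : ValGE ν M x :=
  h.imp_right hMN.trans

theorem add (hF : IsNALocalField ν) (hx : ValGE ν N x) (hy : ValGE ν N y) :
    ValGE ν N (x + y) := by
  rcases hx with rfl | hx
  · simpa using hy
  rcases hy with rfl | hy
  · exact Or.inr (by simpa using hx)
  by_cases h0 : x = 0
  · subst h0
    exact Or.inr (by simpa using hy)
  by_cases h1 : y = 0
  · subst h1
    exact Or.inr (by simpa using hx)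
  by_cases h2 : x + y = 0
  · exact Or.inl h2
  · exact Or.inr ((le_min hx hy).trans (hF.ultrametric x y h0 h1 h2))

theorem neg (hF : IsNALocalField ν) (hx : ValGE ν N x) : ValGE ν N (-x) :=
  hx.imp (by simp) (by simp [hF.val_neg])

theorem sub (hF : IsNALocalField ν) (hx : ValGE ν N x) (hy : ValGE ν N y) :
    ValGE ν N (x - y) := by
  rw [sub_eq_add_neg]
  exact hx.add hF (hy.neg hF)

theorem mul (hF : IsNALocalField ν) (hx : ValGE ν M x) (hy : ValGE ν N y) :
    ValGE ν (M + N) (x * y) := by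
  by_cases h0 : x = 0
  · exact Or.inl (by simp [h0])
  by_cases h1 : y = 0
  · exact Or.inl (by simp [h1])
  refine Or.inr ?_
  rw [hF.map_mul x y h0 h1]
  exact add_le_add (hx.resolve_left h0) (hy.resolve_left h1)

theorem zero : ValGE ν N 0 := Or.inl rfl

theorem one (hF : IsNALocalField ν) : ValGE ν 0 1 := Or.inr hF.val_one.ge

theorem not_one (hF : IsNALocalField ν) : ¬ ValGE ν 1 1 := by
  rintro (h | h)
  · exact one_ne_zero h
  · rw [hF.val_one] at h
    omega

theorem eq_zero_of_forall (h : ∀ N, ValGE ν N x) : x = 0 :=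
  (h (ν x + 1)).elim id fun h => by omega

theorem ne_zero_of_sub_one (hF : IsNALocalField ν) (h : ValGE ν 1 (x - 1)) : x ≠ 0 := by
  rintro rfl
  refine not_one hF ?_
  simpa using h.neg hF

theorem val_eq_zero_of_sub_one (hF : IsNALocalField ν) (h : ValGE ν 1 (x - 1)) : ν x = 0 := by
  have hx := ne_zero_of_sub_one hF h
  have h0 : ValGE ν 0 x := by
    simpa using (h.mono zero_le_one).add hF (one hF)
  refine le_antisymm ?_ (h0.resolve_left hx)
  by_contra! hc
  refine not_one hF ?_
  have : ValGE ν 1 x := Or.inr hc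
  simpa using this.sub hF h

end ValGE

namespace IsNALocalField

variable {K : Type*} [Field K] {ν : K → ℤ}

/-- Newton's iteration for the square root of `x`, started at `1`. -/
noncomputable def sqrtSeq (x : K) : ℕ → K
  | 0 => 1
  | n + 1 => sqrtSeq x n - (sqrtSeq x n ^ 2 - x) * (2 * sqrtSeq x n)⁻¹

theorem valGE_inv_two_mul (hF : IsNALocalField ν) (hodd : OddResidualChar ν) {y : K}
    (hy : ValGE ν 1 (y - 1)) : ValGE ν 0 (2 * y)⁻¹ := by
  have hy0 := ValGE.ne_zero_of_sub_one hF hy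
  have := ValGE.val_eq_zero_of_sub_one hF hy
  refine Or.inr ?_
  rw [hF.val_inv _ (mul_ne_zero hodd.1 hy0), hF.map_mul _ _ hodd.1 hy0, hodd.2, this]
  simp

theorem sqrtSeq_spec (hF : IsNALocalField ν) (hodd : OddResidualChar ν) {x : K}
    (hx : ValGE ν 1 (x - 1)) (n : ℕ) :
    ValGE ν 1 (sqrtSeq x n - 1) ∧ ValGE ν (n + 1) (sqrtSeq x n ^ 2 - x) := by
  induction n with
  | zero =>
    refine ⟨by simpa [sqrtSeq] using ValGE.zero, ?_⟩
    simpa [sqrtSeq] using hx.neg hF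
  | succ n ih =>
    obtain ⟨h1, h2⟩ := ih
    have hy0 := ValGE.ne_zero_of_sub_one hF h1
    have hstep := h2.mul hF (hF.valGE_inv_two_mul hodd h1)
    constructor
    · have := h1.sub hF (hstep.mono (M := 1) (by omega))
      rw [sqrtSeq]
      convert this using 1
      ring
    · have := (hstep.mul hF hstep).mono (M := (n + 1 : ℕ) + 1) (by push_cast; omega)
      rw [sqrtSeq]
      convert this using 1
      have := hodd.1
      field_simp
      ring

theorem sqrtSeq_sub (hF : IsNALocalField ν) (hodd : OddResidualChar ν) {x : K}
    (hx : ValGE ν 1 (x - 1)) (M k : ℕ) :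
    ValGE ν M (sqrtSeq x (M + k) - sqrtSeq x M) := by
  induction k with
  | zero => simpa using ValGE.zero
  | succ k ih =>
    obtain ⟨h1, h2⟩ := hF.sqrtSeq_spec hodd hx (M + k)
    have hstep := h2.mul hF (hF.valGE_inv_two_mul hodd h1)
    have := ih.sub hF (hstep.mono (M := M) (by push_cast; omega))
    rw [← add_assoc, sqrtSeq]
    convert this using 1
    ring

theorem isSquare_of_valGE_sub_one (hF : IsNALocalField ν) (hodd : OddResidualChar ν) {x : K}
    (hx : ValGE ν 1 (x - 1)) : IsSquare x := by
  obtain ⟨L, hL⟩ := hF.complete (sqrtSeq x) fun N => by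
    refine ⟨N.toNat, fun m hm n hn => ?_⟩
    obtain ⟨k, rfl⟩ := Nat.exists_eq_add_of_le hm
    obtain ⟨l, rfl⟩ := Nat.exists_eq_add_of_le hn
    have h := ((hF.sqrtSeq_sub hodd hx N.toNat k).sub hF
      (hF.sqrtSeq_sub hodd hx N.toNat l)).mono (Int.self_le_toNat N)
    rw [sub_sub_sub_cancel_right] at h
    exact h.imp_left sub_eq_zero.1
  refine ⟨L, (sub_eq_zero.1 (ValGE.eq_zero_of_forall (ν := ν) fun N => ?_)).symm⟩
  obtain ⟨M, hM⟩ := hL (max N 0)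
  have h := hM (max M N.toNat) (le_max_left _ _)
  obtain ⟨h1, h2⟩ := hF.sqrtSeq_spec hodd hx (max M N.toNat)
  set y := sqrtSeq x (max M N.toNat)
  have hd : ValGE ν (max N 0) (y - L) := h.imp_left sub_eq_zero.2
  have hd0 : ValGE ν 0 (y - L) := hd.mono (le_max_right _ _)
  have hy : ValGE ν 0 y := by
    simpa using (h1.mono zero_le_one).add hF (ValGE.one hF)
  have hs : ValGE ν 0 (y + L) := by
    convert (hy.add hF hy).sub hF hd0 using 1
    ring
  have h3 := (hd.mul hF hs).mono (M := N) (by simp)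
  have h4 := h2.mono (M := N) (by
    have := Int.self_le_toNat N
    push_cast
    omega)
  convert h4.sub hF h3 using 1
  ring

/-- The ring of integers. -/
def integers (hF : IsNALocalField ν) : Subring K where
  carrier := {x | ValGE ν 0 x}
  mul_mem' hx hy := by simpa using hx.mul hF hy
  one_mem' := ValGE.one hF
  add_mem' hx hy := hx.add hF hy
  zero_mem' := ValGE.zero
  neg_mem' hx := hx.neg hF

/-- The maximal ideal of the ring of integers. -/
def maxIdeal (hF : IsNALocalField ν) : Ideal hF.integers where
  carrier := {x | ValGE ν 1 (x : K)}
  add_mem' hx hy := hx.add hF hy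
  zero_mem' := ValGE.zero
  smul_mem' c x hx := by simpa using c.2.mul hF hx

theorem mem_maxIdeal (hF : IsNALocalField ν) (x : hF.integers) :
    x ∈ hF.maxIdeal ↔ ValGE ν 1 (x : K) := Iff.rfl

instance isMaximal_maxIdeal (hF : IsNALocalField ν) : hF.maxIdeal.IsMaximal := by
  rw [Ideal.isMaximal_iff]
  refine ⟨ValGE.not_one hF, fun J x hJ hx hxJ => ?_⟩
  rw [mem_maxIdeal, ValGE, not_or] at hx
  have hv : ν x = 0 := by
    have := x.2.resolve_left hx.1
    omega
  have hi : ValGE ν 0 (x : K)⁻¹ := Or.inr (by rw [hF.val_inv _ hx.1]; omega)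
  have := J.mul_mem_left ⟨_, hi⟩ hxJ
  convert this
  ext
  exact (inv_mul_cancel₀ hx.1).symm

noncomputable instance (hF : IsNALocalField ν) : Field (hF.integers ⧸ hF.maxIdeal) :=
  Ideal.Quotient.field _

instance finite_residue (hF : IsNALocalField ν) : Finite (hF.integers ⧸ hF.maxIdeal) := by
  classical
  obtain ⟨S, hS⟩ := hF.finiteResidue
  let g : S → hF.integers ⧸ hF.maxIdeal := fun y =>
    if h : ValGE ν 0 (y : K) then Ideal.Quotient.mk _ ⟨y, h⟩ else 0
  refine Finite.of_surjective g fun a => ?_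
  obtain ⟨x, rfl⟩ := Ideal.Quotient.mk_surjective a
  obtain ⟨y, hy, hxy⟩ := hS x x.2
  have h1 : ValGE ν 1 ((x : K) - y) := hxy.imp_left sub_eq_zero.2
  have h0 : ValGE ν 0 y := by
    simpa using ValGE.sub hF x.2 (h1.mono zero_le_one)
  refine ⟨⟨y, hy⟩, ?_⟩
  simp only [g, dif_pos h0]
  rw [eq_comm, Ideal.Quotient.mk_eq_mk_iff_sub_mem]
  exact h1

theorem isSquare_of_isSquare_mk (hF : IsNALocalField ν) (hodd : OddResidualChar ν)
    (u : hF.integers) (hu : ¬ ValGE ν 1 (u : K))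
    (h : IsSquare (Ideal.Quotient.mk hF.maxIdeal u)) : IsSquare (u : K) := by
  obtain ⟨a, ha⟩ := h
  obtain ⟨r, rfl⟩ := Ideal.Quotient.mk_surjective a
  rw [← _root_.map_mul, Ideal.Quotient.mk_eq_mk_iff_sub_mem] at ha
  have hd : ValGE ν 1 ((u : K) - r * r) := ha
  have hr : ¬ ValGE ν 1 (r : K) := fun hr => hu <| by
    convert hd.add hF (by simpa using hr.mul hF r.2) using 1
    ring
  rw [ValGE, not_or] at hr
  have hi : ValGE ν 0 (r : K)⁻¹ := Or.inr (by
    have := r.2.resolve_left hr.1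
    rw [hF.val_inv _ hr.1]
    omega)
  obtain ⟨t, ht⟩ := hF.isSquare_of_valGE_sub_one hodd
    (x := (u : K) * ((r : K)⁻¹ * (r : K)⁻¹)) (by
      have := hd.mul hF (hi.mul hF hi)
      simp only [add_zero] at this
      convert this using 1
      have := hr.1
      field_simp)
  refine ⟨r * t, ?_⟩
  have := hr.1
  field_simp at ht
  linear_combination ht

theorem exists_unit_of_even (hF : IsNALocalField ν) {x : K} (hx : x ≠ 0) (he : Even (ν x)) :
    ∃ (w : K) (u : hF.integers), w ≠ 0 ∧ ¬ ValGE ν 1 (u : K) ∧ (u : K) = x * w ^ 2 := by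
  obtain ⟨n, hn⟩ := he
  obtain ⟨w, hw, hwn⟩ := hF.surj (-n)
  have hv : ν (x * w ^ 2) = 0 := by
    rw [pow_two, hF.map_mul _ _ hx (mul_ne_zero hw hw), hF.map_mul _ _ hw hw]
    omega
  refine ⟨w, ⟨x * w ^ 2, Or.inr hv.ge⟩, hw, ?_, rfl⟩
  rintro (h | h)
  · exact mul_ne_zero hx (pow_ne_zero 2 hw) h
  · simp only at h
    omega

theorem isSquare_mul_of_not_isSquare {k : Type*} [Field k] [Finite k] {a b : k}
    (ha : ¬ IsSquare a) (hb : ¬ IsSquare b) : IsSquare (a * b) := by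
  classical
  have := Fintype.ofFinite k
  by_cases h2 : ringChar k = 2
  · exact FiniteField.isSquare_of_char_two h2 _
  by_contra h
  rw [← quadraticChar_neg_one_iff_not_isSquare] at ha hb h
  rw [_root_.map_mul, ha, hb] at h
  norm_num at h

theorem isSquare_mul (hF : IsNALocalField ν) (hodd : OddResidualChar ν) {x y : K}
    (hx0 : x ≠ 0) (hy0 : y ≠ 0) (hxe : Even (ν x)) (hye : Even (ν y))
    (hx : ¬ IsSquare x) (hy : ¬ IsSquare y) : IsSquare (x * y) := by
  obtain ⟨w, u, hw, hu, hux⟩ := hF.exists_unit_of_even hx0 hxe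
  obtain ⟨w', u', hw', hu', huy⟩ := hF.exists_unit_of_even hy0 hye
  have aux : ∀ {z w : K}, w ≠ 0 → IsSquare (z * w ^ 2) → IsSquare z := by
    rintro z w hw ⟨t, ht⟩
    refine ⟨t * w⁻¹, ?_⟩
    field_simp
    linear_combination ht
  have h1 : ¬ IsSquare (Ideal.Quotient.mk hF.maxIdeal u) := fun h =>
    hx (aux hw (hux ▸ hF.isSquare_of_isSquare_mk hodd u hu h))
  have h2 : ¬ IsSquare (Ideal.Quotient.mk hF.maxIdeal u') := fun h =>
    hy (aux hw' (huy ▸ hF.isSquare_of_isSquare_mk hodd u' hu' h))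
  have h3 := isSquare_mul_of_not_isSquare h1 h2
  rw [← _root_.map_mul] at h3
  have hp : ¬ ValGE ν 1 ((u * u' : hF.integers) : K) := by
    have hm := Ideal.IsMaximal.isPrime (isMaximal_maxIdeal hF)
    exact fun h => (hm.mem_or_mem (x := u) (y := u') h).elim hu hu'
  have h4 := hF.isSquare_of_isSquare_mk hodd _ hp h3
  refine aux (mul_ne_zero hw hw') ?_
  convert h4 using 1
  push_cast
  rw [hux, huy]
  ring

open Polynomial in
theorem exists_unit_combination {k : Type*} [Field k] [Finite k] {a b : k}
    (ha : a ≠ 0) (hb : b ≠ 0) : ∃ s t : k, a * s ^ 2 + b * t ^ 2 = -1 := by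
  have := Fintype.ofFinite k
  by_cases h2 : ringChar k = 2
  · obtain ⟨r, hr⟩ := FiniteField.isSquare_of_char_two h2 (-a⁻¹)
    exact ⟨r, 0, by rw [pow_two, ← hr]; field_simp; simp⟩
  have hodd : Fintype.card k % 2 = 1 := FiniteField.odd_card_of_char_ne_two h2
  obtain ⟨s, t, h⟩ := FiniteField.exists_root_sum_quadratic
    (f := C a * X ^ 2 + C 0 * X + C 1) (g := C b * X ^ 2 + C 0 * X + C 0)
    (degree_quadratic ha) (degree_quadratic hb) hodd
  refine ⟨s, t, ?_⟩
  simp at h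
  linear_combination h

/-- A ternary quadratic form with coefficients of even valuation, one of them `1`, is isotropic. -/
theorem exists_sq_add_eq_zero (hF : IsNALocalField ν) (hodd : OddResidualChar ν) {x y : K}
    (hx0 : x ≠ 0) (hy0 : y ≠ 0) (hxe : Even (ν x)) (hye : Even (ν y)) :
    ∃ r s t : K, r ≠ 0 ∧ r ^ 2 + x * s ^ 2 + y * t ^ 2 = 0 := by
  obtain ⟨w, u, hw, hu, hux⟩ := hF.exists_unit_of_even hx0 hxe
  obtain ⟨w', u', hw', hu', huy⟩ := hF.exists_unit_of_even hy0 hye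
  obtain ⟨s, t, h⟩ := exists_unit_combination
    (a := Ideal.Quotient.mk hF.maxIdeal u) (b := Ideal.Quotient.mk hF.maxIdeal u')
    (fun h => hu (Ideal.Quotient.eq_zero_iff_mem.1 h))
    (fun h => hu' (Ideal.Quotient.eq_zero_iff_mem.1 h))
  obtain ⟨s, rfl⟩ := Ideal.Quotient.mk_surjective s
  obtain ⟨t, rfl⟩ := Ideal.Quotient.mk_surjective t
  have h' : Ideal.Quotient.mk hF.maxIdeal (-(u * s ^ 2 + u' * t ^ 2)) =
      Ideal.Quotient.mk hF.maxIdeal 1 := by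
    simp only [map_neg, map_add, _root_.map_mul, map_pow, h, map_one, neg_neg]
  rw [Ideal.Quotient.mk_eq_mk_iff_sub_mem] at h'
  have h1 : ValGE ν 1 (-((u : K) * s ^ 2 + u' * t ^ 2) - 1) := h'
  obtain ⟨r, hr⟩ := hF.isSquare_of_valGE_sub_one hodd h1
  refine ⟨r, w * s, w' * t, ?_, ?_⟩
  · rintro rfl
    exact ValGE.ne_zero_of_sub_one hF h1 (by simpa using hr)
  · rw [hux, huy] at hr
    linear_combination -hr

theorem exists_isotropic_ternary (hF : IsNALocalField ν) (hodd : OddResidualChar ν) {a b c : K}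
    (ha : a ≠ 0) (hb : b ≠ 0) (hc : c ≠ 0) (hab : Even (ν a + ν b)) (hac : Even (ν a + ν c)) :
    ∃ r s t : K, r ≠ 0 ∧ a * r ^ 2 + b * s ^ 2 + c * t ^ 2 = 0 := by
  obtain ⟨r, s, t, hr, h⟩ := hF.exists_sq_add_eq_zero hodd
    (mul_ne_zero ha hb) (mul_ne_zero ha hc)
    (by rwa [hF.map_mul _ _ ha hb]) (by rwa [hF.map_mul _ _ ha hc])
  exact ⟨r, a * s, a * t, hr, by linear_combination a * h⟩

/-- An anisotropic quaternary diagonal form has square discriminant. -/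
theorem isSquare_discr_of_anisotropic (hF : IsNALocalField ν) (hodd : OddResidualChar ν)
    {a b c d : K} (h : ∀ r s t u : K, a * r ^ 2 + b * s ^ 2 + c * t ^ 2 + d * u ^ 2 = 0 →
      r = 0 ∧ s = 0 ∧ t = 0 ∧ u = 0) : IsSquare (a * b * c * d) := by
  have ha : a ≠ 0 := by
    rintro rfl
    simpa using h 1 0 0 0
  have hb : b ≠ 0 := by
    rintro rfl
    simpa using h 0 1 0 0
  have hc : c ≠ 0 := by
    rintro rfl
    simpa using h 0 0 1 0
  have hd : d ≠ 0 := by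
    rintro rfl
    simpa using h 0 0 0 1
  have habc : ¬ (Even (ν a + ν b) ∧ Even (ν a + ν c)) := fun ⟨h1, h2⟩ => by
    obtain ⟨r, s, t, hr, h0⟩ := hF.exists_isotropic_ternary hodd ha hb hc h1 h2
    exact hr (h r s t 0 (by linear_combination h0)).1
  have habd : ¬ (Even (ν a + ν b) ∧ Even (ν a + ν d)) := fun ⟨h1, h2⟩ => by
    obtain ⟨r, s, t, hr, h0⟩ := hF.exists_isotropic_ternary hodd ha hb hd h1 h2
    exact hr (h r s 0 t (by linear_combination h0)).1
  have hacd : ¬ (Even (ν a + ν c) ∧ Even (ν a + ν d)) := fun ⟨h1, h2⟩ => by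
    obtain ⟨r, s, t, hr, h0⟩ := hF.exists_isotropic_ternary hodd ha hc hd h1 h2
    exact hr (h r 0 s t (by linear_combination h0)).1
  have hbcd : ¬ (Even (ν b + ν c) ∧ Even (ν b + ν d)) := fun ⟨h1, h2⟩ => by
    obtain ⟨r, s, t, hr, h0⟩ := hF.exists_isotropic_ternary hodd hb hc hd h1 h2
    exact hr (h 0 r s t (by linear_combination h0)).2.1
  have aux : ∀ x y z w : K, x ≠ 0 → y ≠ 0 → z ≠ 0 → w ≠ 0 →
      (∀ r s : K, x * r ^ 2 + y * s ^ 2 = 0 → s = 0) →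
      (∀ r s : K, z * r ^ 2 + w * s ^ 2 = 0 → s = 0) →
      Even (ν x + ν y) → Even (ν z + ν w) → IsSquare (x * y * (z * w)) := by
    intro x y z w hx hy hz hw h1 h2 he1 he2
    have key : ∀ x y : K, x ≠ 0 → (∀ r s : K, x * r ^ 2 + y * s ^ 2 = 0 → s = 0) →
        ¬ IsSquare (-(x * y)) := by
      rintro x y hx h ⟨r, hr⟩
      exact hx (h r x (by linear_combination (-x) * hr))
    rw [← neg_mul_neg]
    refine hF.isSquare_mul hodd (neg_ne_zero.2 (mul_ne_zero hx hy))
      (neg_ne_zero.2 (mul_ne_zero hz hw)) ?_ ?_ (key x y hx h1) (key z w hz h2)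
    · rwa [hF.val_neg, hF.map_mul _ _ hx hy]
    · rwa [hF.val_neg, hF.map_mul _ _ hz hw]
  simp only [Int.even_add] at habc habd hacd hbcd
  by_cases hab : Even (ν a + ν b)
  · convert aux a b c d ha hb hc hd
      (fun r s h0 => (h r s 0 0 (by linear_combination h0)).2.1)
      (fun r s h0 => (h 0 0 r s (by linear_combination h0)).2.2.2) hab
      (by rw [Int.even_add] at hab ⊢; grind) using 1
    ring
  by_cases hac : Even (ν a + ν c)
  · convert aux a c b d ha hc hb hd
      (fun r s h0 => (h r 0 s 0 (by linear_combination h0)).2.2.1)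
      (fun r s h0 => (h 0 r 0 s (by linear_combination h0)).2.2.2) hac
      (by rw [Int.even_add] at hab hac ⊢; grind) using 1
    ring
  · convert aux a d b c ha hd hb hc
      (fun r s h0 => (h r 0 0 s (by linear_combination h0)).2.2.2)
      (fun r s h0 => (h 0 r s 0 (by linear_combination h0)).2.2.1)
      (by rw [Int.even_add] at hab hac ⊢; grind)
      (by rw [Int.even_add] at hab hac ⊢; grind) using 1
    ring

end IsNALocalField

section QuarticExtension

variable {F E : Type*} [Field F] [Field E] [Algebra F E]

theorem exists_basis_pow_four [FiniteDimensional F E] (hdim : Module.finrank F E = 4) {β : E}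
    (hβ : Algebra.adjoin F {β} = ⊤) :
    ∃ b : Module.Basis (Fin 4) F E, ∀ i, b i = β ^ (i : ℕ) := by
  let pb := PowerBasis.ofAdjoinEqTop (Algebra.IsIntegral.isIntegral (R := F) β) hβ
  have hd : pb.dim = 4 := pb.finrank.symm.trans hdim
  refine ⟨pb.basis.reindex (finCongr hd), fun i => ?_⟩
  rw [Module.Basis.reindex_apply, pb.basis_eq_pow]
  rfl

/-- The coefficients of an element in the basis `1, s, β, β * s` where `s` is the trace-free part
of `β ^ 2`. -/
structure QuarticCoords (F : Type*) {E : Type*} [Field F] [Field E] [Algebra F E]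
    (σ : E ≃ₐ[F] E) (β s : E) (h D : F) : Prop where
  sq_s : s ^ 2 = algebraMap F E D
  sq_β : β ^ 2 = algebraMap F E h + s
  map_s : σ s = s
  span : ∀ x : E, ∃ p q r t : F, x = algebraMap F E p + algebraMap F E q * s +
    β * (algebraMap F E r + algebraMap F E t * s)
  indep : ∀ p q r t : F, algebraMap F E p + algebraMap F E q * s +
    β * (algebraMap F E r + algebraMap F E t * s) = 0 → p = 0 ∧ q = 0 ∧ r = 0 ∧ t = 0

theorem exists_quarticCoords [FiniteDimensional F E] (h2 : (2 : F) ≠ 0)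
    (hdim : Module.finrank F E = 4)
    {σ : E ≃ₐ[F] E} {β : E} (hβσ : σ β = -β) (hβ : Algebra.adjoin F {β} = ⊤) :
    ∃ s h D, QuarticCoords F σ β s h D := by
  have h2E : (2 : E) ≠ 0 := by
    rw [← map_ofNat (algebraMap F E) 2]
    exact (map_ne_zero _).2 h2
  obtain ⟨b, hb⟩ := exists_basis_pow_four hdim hβ
  have span : ∀ x : E, ∃ p q r t : F, x = algebraMap F E p + algebraMap F E q * β +
      algebraMap F E r * β ^ 2 + algebraMap F E t * β ^ 3 := fun x => by
    have := b.sum_repr x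
    simp only [Fin.sum_univ_four, hb, Algebra.smul_def] at this
    exact ⟨_, _, _, _, by simpa using this.symm⟩
  have indep : ∀ p q r t : F, algebraMap F E p + algebraMap F E q * β +
      algebraMap F E r * β ^ 2 + algebraMap F E t * β ^ 3 = 0 →
      p = 0 ∧ q = 0 ∧ r = 0 ∧ t = 0 := fun p q r t h0 => by
    have := Fintype.linearIndependent_iff.1 b.linearIndependent ![p, q, r, t]
      (by simpa [Fin.sum_univ_four, hb, Algebra.smul_def] using h0)
    exact ⟨this 0, this 1, this 2, this 3⟩
  have hβ0 : β ≠ 0 := fun h0 => by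
    simpa using indep 0 1 0 0 (by simp [h0])
  obtain ⟨p, q, r, t, h4⟩ := span (β ^ 4)
  have hodd : algebraMap F E q + algebraMap F E t * β ^ 2 = 0 := by
    have h5 := congrArg σ h4
    simp only [map_add, map_mul, map_pow, hβσ, AlgEquiv.commutes] at h5
    have : (2 * β) * (algebraMap F E q + algebraMap F E t * β ^ 2) = 0 := by
      linear_combination h5 - h4
    exact (mul_eq_zero.1 this).resolve_left (mul_ne_zero h2E hβ0)
  have hr2 : algebraMap F E (r / 2) = algebraMap F E r / 2 := by
    rw [map_div₀, map_ofNat]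
  refine ⟨β ^ 2 - algebraMap F E (r / 2), r / 2, p + (r / 2) ^ 2, ?_, by ring, ?_, ?_, ?_⟩
  · simp only [map_add, map_pow, hr2]
    field_simp
    linear_combination 4 * h4 + 4 * β * hodd
  · simp [hβσ]
  · intro x
    obtain ⟨x0, x1, x2, x3, hx⟩ := span x
    refine ⟨x0 + x2 * (r / 2), x2, x1 + x3 * (r / 2), x3, ?_⟩
    rw [hx]
    simp only [map_add, map_mul]
    ring
  · intro x0 x1 x2 x3 hx
    obtain ⟨h0, h1, h3, h4⟩ := indep (x0 - x1 * (r / 2)) (x2 - x3 * (r / 2)) x1 x3 (by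
      rw [← hx]
      simp only [map_sub, map_mul]
      ring)
    subst h3 h4
    simpa using And.intro h0 h1

namespace QuarticCoords

variable {σ : E ≃ₐ[F] E} {β s : E} {h D : F}

theorem exists_basis (hq : QuarticCoords F σ β s h D) (hdim : Module.finrank F E = 4) :
    ∃ b : Module.Basis (Fin 4) F E, ⇑b = ![1, s, β, β * s] := by
  have hli : LinearIndependent F ![1, s, β, β * s] := by
    rw [Fintype.linearIndependent_iff]
    intro g hg
    simp [Fin.sum_univ_four, Algebra.smul_def] at hg
    obtain ⟨h0, h1, h2, h3⟩ := hq.indep (g 0) (g 1) (g 2) (g 3) (by linear_combination hg)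
    intro i
    fin_cases i <;> assumption
  exact ⟨basisOfLinearIndependentOfCardEqFinrank hli (by simp [hdim]), by simp⟩

theorem trace_s (hq : QuarticCoords F σ β s h D) (hdim : Module.finrank F E = 4) :
    Algebra.trace F E s = 0 := by
  obtain ⟨b, hb⟩ := hq.exists_basis hdim
  have e0 : s * b 0 = b 1 := by simp [hb]
  have e1 : s * b 1 = D • b 0 := by
    simp only [hb, Algebra.smul_def]
    simpa [pow_two] using hq.sq_s
  have e2 : s * b 2 = b 3 := by simp [hb, mul_comm]
  have e3 : s * b 3 = D • b 2 := by
    simp only [hb, Algebra.smul_def]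
    simp
    linear_combination β * hq.sq_s
  rw [Algebra.trace_eq_matrix_trace b, Matrix.trace, Fin.sum_univ_four]
  simp [Algebra.leftMulMatrix_eq_repr_mul, e0, e1, e2, e3]

theorem trace_eq (hq : QuarticCoords F σ β s h D) (hdim : Module.finrank F E = 4) (p q : F) :
    Algebra.trace F E (algebraMap F E p + algebraMap F E q * s) = 4 * p := by
  rw [map_add, Algebra.trace_algebraMap, ← Algebra.smul_def, map_smul, hq.trace_s hdim, hdim]
  simp

theorem β_ne_zero (hq : QuarticCoords F σ β s h D) : β ≠ 0 := fun h0 => by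
  simpa using hq.indep 0 0 1 0 (by simp [h0])

theorem s_ne_zero (hq : QuarticCoords F σ β s h D) : s ≠ 0 := fun h0 => by
  simpa using hq.indep 0 1 0 0 (by simp [h0])

theorem D_ne_zero (hq : QuarticCoords F σ β s h D) : D ≠ 0 := by
  rintro rfl
  refine hq.s_ne_zero ?_
  simpa using hq.sq_s

theorem exists_of_fixed (hq : QuarticCoords F σ β s h D) (h2 : (2 : F) ≠ 0) (hβσ : σ β = -β)
    {c : E} (hc : σ c = c) : ∃ p q : F, c = algebraMap F E p + algebraMap F E q * s := by
  have h2E : (2 : E) ≠ 0 := by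
    rw [← map_ofNat (algebraMap F E) 2]
    exact (map_ne_zero _).2 h2
  obtain ⟨p, q, r, t, rfl⟩ := hq.span c
  refine ⟨p, q, ?_⟩
  simp only [map_add, map_mul, hβσ, AlgEquiv.commutes, hq.map_s] at hc
  refine mul_left_cancel₀ h2E ?_
  linear_combination -hc

theorem discr_ne_zero (hq : QuarticCoords F σ β s h D) : h ^ 2 - D ≠ 0 := fun h0 => by
  have h1 : β ^ 2 * (algebraMap F E h - s) = 0 := by
    have := congrArg (algebraMap F E) h0
    simp only [map_sub, map_pow, map_zero] at this
    linear_combination (algebraMap F E h - s) * hq.sq_β + this - hq.sq_s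
  have h3 := (mul_eq_zero.1 h1).resolve_left (pow_ne_zero 2 hq.β_ne_zero)
  simpa using hq.indep h (-1) 0 0 (by
    simp only [map_neg, map_one, map_zero]
    linear_combination h3)

open Polynomial in
theorem separable (hq : QuarticCoords F σ β s h D) (h2 : (2 : F) ≠ 0) :
    ((X ^ 2 - C h) ^ 2 - C D : F[X]).Separable := by
  have hN : D ^ 2 - h ^ 2 * D ≠ 0 := by
    have := mul_ne_zero hq.D_ne_zero hq.discr_ne_zero
    contrapose! this
    linear_combination -this
  have hinv : C (D ^ 2 - h ^ 2 * D) * C (D ^ 2 - h ^ 2 * D)⁻¹ = 1 := by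
    rw [← C_mul, mul_inv_cancel₀ hN, C_1]
  have h4 : (4 : F[X]) * C 4⁻¹ = 1 := by
    have h4 : (4 : F) ≠ 0 := by
      have := mul_ne_zero h2 h2
      norm_num at this
      exact this
    have : (4 : F[X]) = C 4 := (map_ofNat C 4).symm
    rw [this, ← C_mul, mul_inv_cancel₀ h4, C_1]
  refine ⟨C (D ^ 2 - h ^ 2 * D)⁻¹ * (C h ^ 2 - (C D - C h * (X ^ 2 - C h))),
    C (D ^ 2 - h ^ 2 * D)⁻¹ * (C D - C h * (X ^ 2 - C h)) * X * C 4⁻¹, ?_⟩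
  simp only [derivative_sub, derivative_pow, derivative_X, derivative_C]
  simp only [C_sub, C_mul, C_pow] at hinv
  norm_num [map_ofNat]
  linear_combination hinv + C (D ^ 2 - h ^ 2 * D)⁻¹ * (C D - C h * (X ^ 2 - C h)) * X ^ 2 *
    (X ^ 2 - C h) * h4

theorem isBiquadratic [FiniteDimensional F E] (hq : QuarticCoords F σ β s h D) (h2 : (2 : F) ≠ 0)
    (hdim : Module.finrank F E = 4) (hβ : Algebra.adjoin F {β} = ⊤)
    (hsq : IsSquare (h ^ 2 - D)) : IsBiquadratic F E := by
  obtain ⟨m, hm⟩ := hsq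
  have hβ0 := hq.β_ne_zero
  have hm0 : m ≠ 0 := by
    rintro rfl
    exact hq.discr_ne_zero (by simpa using hm)
  have hm0E : algebraMap F E m ≠ 0 := (map_ne_zero _).2 hm0
  have hmE : algebraMap F E h ^ 2 - s ^ 2 = algebraMap F E m ^ 2 := by
    have := congrArg (algebraMap F E) hm
    simp only [map_sub, map_pow, map_mul] at this
    linear_combination this - hq.sq_s
  set γ := algebraMap F E m / β with hγ
  have hγβ : γ * β = algebraMap F E m := by
    rw [hγ]
    field_simp
  have hγ2 : γ ^ 2 = algebraMap F E h - s := by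
    refine mul_right_cancel₀ (pow_ne_zero 2 hβ0) ?_
    rw [← mul_pow, hγβ, hq.sq_β, ← hmE]
    ring
  have hfac : ∀ x : E, (x ^ 2 - algebraMap F E h) ^ 2 - algebraMap F E D =
      (x - β) * (x + β) * ((x - γ) * (x + γ)) := fun x => by
    have h1 : (x - β) * (x + β) = x ^ 2 - algebraMap F E h - s := by
      linear_combination -hq.sq_β
    have h2 : (x - γ) * (x + γ) = x ^ 2 - algebraMap F E h + s := by
      linear_combination -hγ2
    rw [h1, h2, ← hq.sq_s]
    ring
  open Polynomial in
  have hgal : IsGalois F E := by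
    have hsplit : ((X ^ 2 - C h) ^ 2 - C D : F[X]).map (algebraMap F E) =
        (X - C β) * (X - C (-β)) * ((X - C γ) * (X - C (-γ))) := by
      have h1 : (X - C β) * (X - C (-β)) = X ^ 2 - C (algebraMap F E h) - C s := by
        have := congrArg C hq.sq_β
        simp only [C_pow, C_add] at this
        simp only [C_neg]
        linear_combination -this
      have h2 : (X - C γ) * (X - C (-γ)) = X ^ 2 - C (algebraMap F E h) + C s := by
        have := congrArg C hγ2
        simp only [C_pow, C_sub] at this
        simp only [C_neg]
        linear_combination -this
      have h3 := congrArg C hq.sq_s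
      simp only [C_pow] at h3
      rw [h1, h2]
      simp only [Polynomial.map_sub, Polynomial.map_pow, map_X, map_C]
      linear_combination h3
    have : ((X ^ 2 - C h) ^ 2 - C D : F[X]).IsSplittingField F E := by
      constructor
      · rw [hsplit]
        exact ((Splits.X_sub_C _).mul (Splits.X_sub_C _)).mul
          ((Splits.X_sub_C _).mul (Splits.X_sub_C _))
      · rw [eq_top_iff, ← hβ]
        refine Algebra.adjoin_mono (Set.singleton_subset_iff.2 ?_)
        rw [mem_rootSet]
        refine ⟨(hq.separable h2).ne_zero, ?_⟩
        simp [hfac]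
    exact IsGalois.of_separable_splitting_field (hq.separable h2)
  have hcard : Nat.card (E ≃ₐ[F] E) = 4 := (IsGalois.card_aut_eq_finrank F E).trans hdim
  have hinv : ∀ ρ : E ≃ₐ[F] E, ρ ^ 2 = 1 := fun ρ => by
    have hρβ : ρ (ρ β) = β := by
      have h0 := hfac β
      rw [sub_self, zero_mul, zero_mul] at h0
      have h1 := congrArg ρ h0
      simp only [map_sub, map_pow, map_zero, AlgEquiv.commutes] at h1
      rw [hfac] at h1
      have hργ : ρ γ = algebraMap F E m / ρ β := by
        rw [hγ, map_div₀, AlgEquiv.commutes]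
      have hγγ : algebraMap F E m / γ = β := by
        rw [hγ]
        field_simp
      simp only [mul_eq_zero, sub_eq_zero, add_eq_zero_iff_eq_neg] at h1
      rcases h1 with (h1 | h1) | (h1 | h1) <;> simp [h1, hργ, hγγ, div_neg]
    have hext : ((ρ ^ 2 : E ≃ₐ[F] E) : E →ₐ[F] E) = AlgHom.id F E :=
      AlgHom.ext_of_adjoin_eq_top hβ (by simpa [Set.EqOn, pow_two] using hρβ)
    ext x
    exact DFunLike.congr_fun hext x
  have : IsKleinFour (E ≃ₐ[F] E) := by
    refine ⟨hcard, ?_⟩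
    have hdvd := Monoid.exponent_dvd_of_forall_pow_eq_one hinv
    rcases (Nat.dvd_prime Nat.prime_two).1 hdvd with h1 | h1
    · have := Monoid.exp_eq_one_iff.1 h1
      rw [Nat.card_of_subsingleton 1] at hcard
      omega
    · exact h1
  exact ⟨hgal, IsKleinFour.nonempty_mulEquiv⟩

theorem isSquare_discr (hq : QuarticCoords F σ β s h D) {ν : F → ℤ} (hF : IsNALocalField ν)
    (hodd : OddResidualChar ν) (hdim : Module.finrank F E = 4) (hβσ : σ β = -β)
    {c : E} (hc : σ c = c)
    (hani : ∀ x : E, Algebra.trace F E (c * (x * σ x)) = 0 → x = 0) : IsSquare (h ^ 2 - D) := by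
  obtain ⟨p, r, rfl⟩ := hq.exists_of_fixed hodd.1 hβσ hc
  have hp : p ≠ 0 := by
    rintro rfl
    refine one_ne_zero (hani 1 ?_)
    simpa using hq.trace_eq hdim 0 r
  obtain ⟨p', hp'⟩ : ∃ p', p' = p * h + r * D := ⟨_, rfl⟩
  obtain ⟨r', hr'⟩ : ∃ r', r' = p + r * h := ⟨_, rfl⟩
  have hcβ : (algebraMap F E p + algebraMap F E r * s) * β ^ 2 =
      algebraMap F E p' + algebraMap F E r' * s := by
    rw [hp', hr', hq.sq_β]
    simp only [map_add, map_mul]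
    linear_combination algebraMap F E r * hq.sq_s
  have hp'0 : p' ≠ 0 := fun h0 => by
    refine hq.β_ne_zero (hani β ?_)
    rw [hβσ, mul_neg, mul_neg, ← pow_two, hcβ, map_neg, hq.trace_eq hdim, h0]
    simp
  have hform : ∀ t u v w : F, p * t ^ 2 + p * D * (p ^ 2 - r ^ 2 * D) * u ^ 2 + -p' * v ^ 2 +
      -(p' * D * (p' ^ 2 - r' ^ 2 * D)) * w ^ 2 = 0 → t = 0 ∧ u = 0 ∧ v = 0 ∧ w = 0 := by
    intro t u v w h0
    have hx := hani (algebraMap F E (t - r * D * u) + algebraMap F E (p * u) * s +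
      β * (algebraMap F E (v - r' * D * w) + algebraMap F E (p' * w) * s)) (by
        have hs := hq.sq_s
        have key : (algebraMap F E p + algebraMap F E r * s) *
            ((algebraMap F E (t - r * D * u) + algebraMap F E (p * u) * s +
              β * (algebraMap F E (v - r' * D * w) + algebraMap F E (p' * w) * s)) *
            σ (algebraMap F E (t - r * D * u) + algebraMap F E (p * u) * s +
              β * (algebraMap F E (v - r' * D * w) + algebraMap F E (p' * w) * s))) =
            algebraMap F E (p * t ^ 2 + p * D * (p ^ 2 - r ^ 2 * D) * u ^ 2 + -p' * v ^ 2 +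
              -(p' * D * (p' ^ 2 - r' ^ 2 * D)) * w ^ 2) +
            algebraMap F E (r * ((t - r * D * u) ^ 2 + (p * u) ^ 2 * D) +
              2 * p * (t - r * D * u) * (p * u) -
              r' * ((v - r' * D * w) ^ 2 + (p' * w) ^ 2 * D) -
              2 * p' * (v - r' * D * w) * (p' * w)) * s := by
          simp only [map_add, map_mul, map_sub, map_neg, map_pow, hβσ, AlgEquiv.commutes, hq.map_s,
            map_ofNat]
          generalize algebraMap F E p = P, algebraMap F E r = R, algebraMap F E p' = P',
            algebraMap F E r' = R', algebraMap F E D = Δ, algebraMap F E t = T,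
            algebraMap F E u = U, algebraMap F E v = V, algebraMap F E w = W at hcβ hs ⊢
          linear_combination (-(V - R' * Δ * W + P' * W * s) ^ 2) * hcβ +
            (P * (P * U) ^ 2 + 2 * R * (T - R * Δ * U) * (P * U) + R * (P * U) ^ 2 * s -
              (P' * (P' * W) ^ 2 + 2 * R' * (V - R' * Δ * W) * (P' * W) +
                R' * (P' * W) ^ 2 * s)) * hs
        rw [key, hq.trace_eq hdim, h0, mul_zero])
    obtain ⟨e1, e2, e3, e4⟩ := hq.indep _ _ _ _ hx
    have hu : u = 0 := (mul_eq_zero.1 e2).resolve_left hp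
    have hw : w = 0 := (mul_eq_zero.1 e4).resolve_left hp'0
    subst hu hw
    simpa using And.intro e1 e3
  have hsq := hF.isSquare_discr_of_anisotropic hodd hform
  have hB : p * D * (p ^ 2 - r ^ 2 * D) ≠ 0 := fun h0 => by
    simpa using hform 0 1 0 0 (by linear_combination h0)
  obtain ⟨y, hy⟩ := hsq
  have hM : p * D * (p ^ 2 - r ^ 2 * D) * p' ≠ 0 := mul_ne_zero hB hp'0
  refine ⟨y / (p * D * (p ^ 2 - r ^ 2 * D) * p'), ?_⟩
  rw [div_mul_div_comm, ← hy, eq_div_iff (mul_ne_zero hM hM), hp', hr']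
  ring

end QuarticCoords

end QuarticExtension

/-- case (i) of Proposition 4.2 with Proposition 4.1.
With `V = E` regarded as 4-dimensional symplectic `F`-space via
`h(x,y) = tr_{E/F}(δ₀ x σ(y))`, the quadratic form `q(x) = h(x, βx)` is
anisotropic iff `E/F` is biquadratic and, for every `σ`-fixed `z ∈ E₀^×` with
`tr_{E₀/F}(z) = 0` (equivalently `tr_{E/F}(z) = 0`), the element `β δ₀ z⁻¹` is
not a norm from `E` to `E₀` (norms being the elements `w·σ(w)`, `w ∈ E^×`). -/
theorem anisotropic_iff_biquadratic_and_coset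
    {F E : Type*} [Field F] [Field E] [Algebra F E] [FiniteDimensional F E]
    (ν : F → ℤ) (hF : IsNALocalField ν) (hodd : OddResidualChar ν)
    (hdim : Module.finrank F E = 4)
    (σ : E ≃ₐ[F] E) (hσ2 : ∀ x : E, σ (σ x) = x)
    (hσne : σ ≠ (AlgEquiv.refl : E ≃ₐ[F] E))
    (β : E) (hβskew : σ β = -β) (hβgen : Algebra.adjoin F {β} = ⊤)
    (δ₀ : E) (hδ₀ : δ₀ ≠ 0) (hδ₀skew : σ δ₀ = -δ₀) :
    (∀ x : E, Algebra.trace F E (δ₀ * x * σ (β * x)) = 0 → x = 0) ↔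
      (IsBiquadratic F E ∧
        ∀ z : E, z ≠ 0 → σ z = z → Algebra.trace F E z = 0 →
          ¬∃ w : E, w ≠ 0 ∧ β * δ₀ * z⁻¹ = w * σ w) := by
  have hc : σ (β * δ₀) = β * δ₀ := by rw [map_mul, hβskew, hδ₀skew, neg_mul_neg]
  have htr : ∀ x : E, Algebra.trace F E (δ₀ * x * σ (β * x)) =
      -Algebra.trace F E (β * δ₀ * (x * σ x)) := fun x => by
    rw [← map_neg, map_mul σ, hβskew]
    congr 1
    ring
  simp only [htr, neg_eq_zero]
  obtain ⟨s, h, D, hq⟩ := exists_quarticCoords hodd.1 hdim hβskew hβgen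
  constructor
  · intro hani
    refine ⟨hq.isBiquadratic hodd.1 hdim hβgen
      (hq.isSquare_discr hF hodd hdim hβskew hc hani), ?_⟩
    rintro z hz - htz ⟨w, hw, hwz⟩
    refine inv_ne_zero hw (hani w⁻¹ ?_)
    have hσw : σ w ≠ 0 := by simpa using hw
    convert htz using 2
    rw [map_inv₀, ← mul_inv, ← hwz]
    have := hq.β_ne_zero
    field_simp
  · rintro ⟨-, hcoset⟩ x hx
    by_contra hx0
    have hσx : σ x ≠ 0 := by simpa using hx0
    have := hq.β_ne_zero
    refine hcoset (β * δ₀ * (x * σ x)) (by simp_all) ?_ hx ⟨x⁻¹, inv_ne_zero hx0, ?_⟩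
    · rw [map_mul, hc, map_mul, hσ2, mul_comm (σ x)]
    · rw [map_inv₀]
      field_simp
end

section
/- Let σ be the nontrivial F-automorphism of E₀ and let u ∈ E₀^× satisfy σ(u) u⁻¹ ∈ 1 + 𝔭_{E₀}. Then u ∈ F^× · (E₀^×)². (Claim established in the proof of Lemma 5.2.1.) -/
namespace IsNALocalField

variable {K : Type*} [Field K] {ν : K → ℤ}

/-- The fractional ideal of elements of valuation at least `n`. -/
def MemPow (ν : K → ℤ) (n : ℤ) (x : K) : Prop := x = 0 ∨ n ≤ ν x

theorem MemPow.mono {m n : ℤ} {x : K} (hx : MemPow ν n x) (h : m ≤ n) : MemPow ν m x :=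
  hx.imp_right h.trans

theorem map_one (h : IsNALocalField ν) : ν 1 = 0 := by
  have := h.map_mul 1 1 one_ne_zero one_ne_zero
  rw [mul_one] at this
  omega

theorem map_neg_one (h : IsNALocalField ν) : ν (-1) = 0 := by
  have := h.map_mul (-1) (-1) (by simp) (by simp)
  rw [neg_mul_neg, mul_one, h.map_one] at this
  omega

theorem map_neg (h : IsNALocalField ν) (x : K) : ν (-x) = ν x := by
  by_cases hx : x = 0
  · simp [hx]
  · rw [← neg_one_mul, h.map_mul _ _ (by simp) hx, h.map_neg_one, zero_add]

theorem map_inv (h : IsNALocalField ν) {x : K} (hx : x ≠ 0) : ν x⁻¹ = -ν x := by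
  have := h.map_mul x x⁻¹ hx (inv_ne_zero hx)
  rw [mul_inv_cancel₀ hx, h.map_one] at this
  omega

theorem memPow_add (h : IsNALocalField ν) {n : ℤ} {x y : K} (hx : MemPow ν n x)
    (hy : MemPow ν n y) : MemPow ν n (x + y) := by
  by_cases hx0 : x = 0
  · simpa [hx0] using hy
  by_cases hy0 : y = 0
  · simpa [hy0] using hx
  by_cases hxy : x + y = 0
  · exact Or.inl hxy
  · exact Or.inr ((le_min (hx.resolve_left hx0) (hy.resolve_left hy0)).trans
      (h.ultrametric x y hx0 hy0 hxy))

theorem memPow_neg (h : IsNALocalField ν) {n : ℤ} {x : K} (hx : MemPow ν n x) :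
    MemPow ν n (-x) := by
  simpa [MemPow, h.map_neg] using hx

theorem memPow_sub (h : IsNALocalField ν) {n : ℤ} {x y : K} (hx : MemPow ν n x)
    (hy : MemPow ν n y) : MemPow ν n (x - y) := by
  simpa [sub_eq_add_neg] using h.memPow_add hx (h.memPow_neg hy)

theorem memPow_mul (h : IsNALocalField ν) {m n : ℤ} {x y : K} (hx : MemPow ν m x)
    (hy : MemPow ν n y) : MemPow ν (m + n) (x * y) := by
  by_cases hx0 : x = 0
  · simp [MemPow, hx0]
  by_cases hy0 : y = 0
  · simp [MemPow, hy0]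
  · refine Or.inr ?_
    rw [h.map_mul x y hx0 hy0]
    exact add_le_add (hx.resolve_left hx0) (hy.resolve_left hy0)

theorem eq_zero_of_forall_memPow {x : K} (hx : ∀ n, MemPow ν n x) : x = 0 := by
  rcases hx (ν x + 1) with h | h
  · exact h
  · omega

theorem memPow_inv_two (h : IsNALocalField ν) (h2 : OddResidualChar ν) :
    MemPow ν 0 (2⁻¹ : K) :=
  Or.inr (by rw [h.map_inv h2.1, h2.2, neg_zero])

/-- Successive approximations to the root of `2 * y + y ^ 2 = x` close to `0`. -/
def sqrtApprox (x : K) : ℕ → K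
  | 0 => 0
  | n + 1 => (x - sqrtApprox x n ^ 2) * 2⁻¹

theorem memPow_sqrtApprox (h : IsNALocalField ν) (h2 : OddResidualChar ν) {x : K}
    (hx : MemPow ν 1 x) (n : ℕ) : MemPow ν 1 (sqrtApprox x n) := by
  induction n with
  | zero => exact Or.inl rfl
  | succ n ih =>
    have hsq : MemPow ν 1 (sqrtApprox x n ^ 2) := by
      rw [sq]
      exact (h.memPow_mul ih ih).mono (by norm_num)
    simpa [sqrtApprox] using h.memPow_mul (h.memPow_sub hx hsq) (h.memPow_inv_two h2)

theorem memPow_sqrtApprox_succ_sub (h : IsNALocalField ν) (h2 : OddResidualChar ν) {x : K}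
    (hx : MemPow ν 1 x) (n : ℕ) :
    MemPow ν (n + 1) (sqrtApprox x (n + 1) - sqrtApprox x n) := by
  induction n with
  | zero => simpa [sqrtApprox] using h.memPow_mul hx (h.memPow_inv_two h2)
  | succ n ih =>
    have hsum := h.memPow_add (h.memPow_sqrtApprox h2 hx (n + 1)) (h.memPow_sqrtApprox h2 hx n)
    have := h.memPow_neg (h.memPow_mul (h.memPow_mul ih hsum) (h.memPow_inv_two h2))
    convert this using 1
    · push_cast
      ring
    · rw [sqrtApprox, sqrtApprox]
      ring

theorem memPow_sqrtApprox_add_sub (h : IsNALocalField ν) (h2 : OddResidualChar ν) {x : K}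
    (hx : MemPow ν 1 x) (n k : ℕ) :
    MemPow ν (n + 1) (sqrtApprox x (n + k) - sqrtApprox x n) := by
  induction k with
  | zero => exact Or.inl (sub_self _)
  | succ k ih =>
    have := (h.memPow_sqrtApprox_succ_sub h2 hx (n + k)).mono
      (show (n + 1 : ℤ) ≤ (n + k : ℕ) + 1 by push_cast; omega)
    simpa [add_assoc] using h.memPow_add this ih

/-- In odd residual characteristic every principal unit is a square. -/
theorem exists_sq_eq_one_add (h : IsNALocalField ν) (h2 : OddResidualChar ν) {x : K}
    (hx : MemPow ν 1 x) : ∃ w : K, w ^ 2 = 1 + x := by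
  have cauchy : ∀ N : ℤ, ∃ M : ℕ, ∀ m ≥ M, ∀ n ≥ M,
      sqrtApprox x m = sqrtApprox x n ∨ N ≤ ν (sqrtApprox x m - sqrtApprox x n) := by
    intro N
    have key (m : ℕ) (hm : m ≥ N.toNat) :
        MemPow ν N (sqrtApprox x m - sqrtApprox x N.toNat) := by
      obtain ⟨k, rfl⟩ := Nat.exists_eq_add_of_le hm
      exact (h.memPow_sqrtApprox_add_sub h2 hx _ k).mono (by omega)
    refine ⟨N.toNat, fun m hm n hn => ?_⟩
    simpa [MemPow, sub_eq_zero] using h.memPow_sub (key m hm) (key n hn)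
  obtain ⟨L, hL⟩ := h.complete _ cauchy
  have lim (N : ℤ) : ∃ M : ℕ, ∀ m ≥ M, MemPow ν N (sqrtApprox x m - L) := by
    simpa [MemPow, sub_eq_zero] using hL N
  have hL1 : MemPow ν 1 L := by
    obtain ⟨M, hM⟩ := lim 1
    simpa using h.memPow_sub (h.memPow_sqrtApprox h2 hx M) (hM M le_rfl)
  have root : 2 * L + L ^ 2 - x = 0 := by
    refine eq_zero_of_forall_memPow (ν := ν) fun N => ?_
    obtain ⟨M, hM⟩ := lim N
    have hsum := h.memPow_add (h.memPow_sqrtApprox h2 hx M) hL1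
    have e1 := (h.memPow_mul (hM M le_rfl) hsum).mono (show N ≤ N + 1 by omega)
    have e2 := (h.memPow_mul (Or.inr h2.2.ge : MemPow ν 0 (2 : K)) (hM (M + 1) (by omega))).mono
      (show N ≤ 0 + N by omega)
    convert h.memPow_neg (h.memPow_add e1 e2) using 1
    have h20 := h2.1
    rw [sqrtApprox]
    field_simp
    ring
  exact ⟨1 + L, by linear_combination root⟩

end IsNALocalField

section Quadratic

variable {F E : Type*} [Field F] [Field E] [Algebra F E]

theorem AlgEquiv.apply_apply_of_finrank_eq_two [FiniteDimensional F E]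
    (hdim : Module.finrank F E = 2) (σ : E ≃ₐ[F] E)
    (hσ : σ ≠ AlgEquiv.refl) (x : E) : σ (σ x) = x := by
  have : Nontrivial (E ≃ₐ[F] E) := ⟨σ, AlgEquiv.refl, hσ⟩
  have hcard : Nat.card (E ≃ₐ[F] E) = 2 := by
    have h1 : Nat.card (E ≃ₐ[F] E) ≤ 2 := by
      rw [← hdim, Nat.card_eq_fintype_card]
      exact AlgEquiv.card_le
    have h2 : 1 < Nat.card (E ≃ₐ[F] E) := Finite.one_lt_card
    omega
  have hpow : σ ^ 2 = 1 := hcard ▸ pow_card_eq_one'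
  rw [sq] at hpow
  exact DFunLike.congr_fun hpow x

theorem AlgEquiv.mem_range_algebraMap_of_finrank_eq_two (hdim : Module.finrank F E = 2)
    (σ : E ≃ₐ[F] E) (hσ : σ ≠ AlgEquiv.refl) {x : E} (hx : σ x = x) :
    x ∈ (algebraMap F E).range := by
  by_contra hmem
  refine hσ (AlgEquiv.ext fun z => ?_)
  have hli : LinearIndependent F ![(1 : E), x] := by
    rw [LinearIndependent.pair_iff' one_ne_zero]
    intro a ha
    exact hmem ⟨a, by rw [← ha, Algebra.smul_def, mul_one]⟩
  have hz : z ∈ Submodule.span F (Set.range ![(1 : E), x]) := by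
    rw [hli.span_eq_top_of_card_eq_finrank (by simp [hdim])]
    trivial
  rw [Matrix.range_cons, Matrix.range_cons, Matrix.range_empty, Set.union_empty,
    Set.singleton_union, Submodule.mem_span_pair] at hz
  obtain ⟨a, b, rfl⟩ := hz
  simp [hx]

end Quadratic

/-- claim in the proof of Lemma 5.2.1.
Let `E₀/F` be a quadratic extension of nonarchimedean local fields of odd
residual characteristic and `σ` the nontrivial `F`-automorphism of `E₀`.
If `u ∈ E₀^×` satisfies `σ(u)·u⁻¹ ∈ 1 + 𝔭_{E₀}`, then `u ∈ F^×·(E₀^×)²`. -/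
theorem unit_in_Fsq_of_galois_ratio_close_to_one
    {F E₀ : Type*} [Field F] [Field E₀] [Algebra F E₀] [FiniteDimensional F E₀]
    (ν₀ : E₀ → ℤ) (hE₀ : IsNALocalField ν₀) (hodd : OddResidualChar ν₀)
    (hdim : Module.finrank F E₀ = 2)
    (σ : E₀ ≃ₐ[F] E₀) (hσne : σ ≠ (AlgEquiv.refl : E₀ ≃ₐ[F] E₀))
    (u : E₀) (hu : u ≠ 0)
    (hclose : σ u * u⁻¹ = 1 ∨ 0 < ν₀ (σ u * u⁻¹ - 1)) :
    ∃ t : F, ∃ y : E₀, t ≠ 0 ∧ y ≠ 0 ∧ u = algebraMap F E₀ t * y ^ 2 := by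
  have hx : IsNALocalField.MemPow ν₀ 1 (σ u * u⁻¹ - 1) := hclose.imp sub_eq_zero.mpr id
  have h2 := hodd.1
  obtain ⟨w, hw⟩ := hE₀.exists_sq_eq_one_add hodd (x := (σ u * u⁻¹ - 1) * 2⁻¹)
    (by simpa using hE₀.memPow_mul hx (hE₀.memPow_inv_two hodd))
  have hw0 : w ≠ 0 := by
    rintro rfl
    have hneg : σ u * u⁻¹ - 1 = -2 := by
      field_simp at hw ⊢
      linear_combination -hw
    rw [hneg] at hx
    rcases hx with hx | hx
    · exact h2 (neg_eq_zero.mp hx)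
    · rw [hE₀.map_neg, hodd.2] at hx
      omega
  have htr : (u + σ u) * 2⁻¹ = u * w ^ 2 := by
    rw [hw]
    field_simp
    ring
  have hfix : σ ((u + σ u) * 2⁻¹) = (u + σ u) * 2⁻¹ := by
    rw [map_mul, map_add, map_inv₀, map_ofNat, add_comm,
      AlgEquiv.apply_apply_of_finrank_eq_two hdim σ hσne]
  obtain ⟨t, ht⟩ := AlgEquiv.mem_range_algebraMap_of_finrank_eq_two hdim σ hσne hfix
  have hut : algebraMap F E₀ t = u * w ^ 2 := ht.trans htr
  refine ⟨t, w⁻¹, ?_, inv_ne_zero hw0, ?_⟩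
  · rintro rfl
    rw [map_zero] at hut
    exact mul_ne_zero hu (pow_ne_zero 2 hw0) hut.symm
  · rw [hut]
    field_simp
end
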